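/- Fix 1 ≤ p < ∞ and for each n ∈ ℕ let j_n : ℓ_pⁿ → ℓ∞ be an isometric linear embedding, where ℓ_pⁿ is ℝⁿ with the norm (∑|a_i|^p)^{1/p} and ℓ∞ is the space of bounded real sequences with the supremum norm. Let B : X → Y be a bounded operator between real Banach spaces and suppose there is a constant c > 0 such that for every n ∈ ℕ and every closed subspace Z of X of finite codimension, j_n c-factors through the restriction B|_Z : Z → Y; that is, there exist bounded operators C : ℓ_pⁿ → X with range contained in Z and A : Y → ℓ∞ with ‖C‖ ≤ c, ‖A‖ ≤ c and A ∘ B ∘ C = j_n. Then the operator ⊕_{n} j_n from the ℓ₁-sum (⊕_{n} ℓ_pⁿ)_{ℓ₁} to the ℓ∞-sum (⊕_{n} ℓ∞)_{ℓ∞}, defined by (x_n)_n ↦ (j_n x_n)_n, factors through B: there exist bounded operators C : (⊕_n ℓ_pⁿ)_{ℓ₁} → X and A : Y → (⊕_n ℓ∞)_{ℓ∞} with A(B(C x)) = (j_n x_n)_n for every x = (x_n)_n. -/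

import Mathlib

/-!
STATEMENT 12: Fix `1 ≤ p < ∞` and isometric embeddings `jₙ : ℓ_pⁿ → ℓ∞`.  If `B : X → Y`
is a bounded operator between real Banach spaces and there is `c > 0` such that for every
`n` and every closed finite-codimensional subspace `Z` of `X`, the operator `jₙ`
`c`-factors through the restriction `B|_Z`, then the operator
`⊕ₙ jₙ : (⊕ₙ ℓ_pⁿ)_{ℓ₁} → (⊕ₙ ℓ∞)_{ℓ∞}` factors through `B`.
-/

set_option synthInstance.maxHeartbeats 400000
set_option maxHeartbeats 1000000

/-- The space `ℓ∞` of bounded real sequences with the sup norm. -/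
abbrev ellInfty : Type := ↥(lp (fun _ : ℕ => ℝ) ⊤)

/-- `ℓ_pⁿ`: `ℝⁿ` with the norm `(∑ |aᵢ|^p)^{1/p}`. -/
abbrev ellPFin (p : ENNReal) (n : ℕ) : Type := PiLp p (fun _ : Fin n => ℝ)

/-- A uniformly bounded family of operators into the summands defines an operator into their
`ℓ∞`-sum. -/
lemma exists_clm_lp_infty {ι : Type*} {E : ι → Type*} [∀ i, NormedAddCommGroup (E i)]
    [∀ i, NormedSpace ℝ (E i)] {Y : Type*} [NormedAddCommGroup Y] [NormedSpace ℝ Y]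
    {K : ℝ} (hK : 0 ≤ K) (a : ∀ i, Y →L[ℝ] E i) (ha : ∀ i, ‖a i‖ ≤ K) :
    ∃ A : Y →L[ℝ] lp E ⊤, ‖A‖ ≤ K ∧ ∀ y i, A y i = a i y := by
  have hb : ∀ y i, ‖a i y‖ ≤ K * ‖y‖ := fun y i => (a i).le_of_opNorm_le (ha i) y
  have hmem : ∀ y, Memℓp (fun i => a i y) ⊤ := by
    intro y
    apply memℓp_infty
    refine ⟨K * ‖y‖, ?_⟩
    rintro _ ⟨i, rfl⟩
    exact hb y i
  let L : Y →ₗ[ℝ] lp E ⊤ :=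
    { toFun := fun y => ⟨fun i => a i y, hmem y⟩
      map_add' := fun x y => by
        ext i
        exact map_add (a i) x y
      map_smul' := fun r y => by
        ext i
        exact map_smul (a i) r y }
  have hL : ∀ y, ‖L y‖ ≤ K * ‖y‖ := fun y =>
    lp.norm_le_of_forall_le (by positivity) (hb y)
  exact ⟨L.mkContinuous K hL, L.mkContinuous_norm_le hK hL, fun y i => rfl⟩

/-- A uniformly bounded family of operators on the summands defines an operator on their
`ℓ₁`-sum. -/
lemma exists_clm_lp_one {ι : Type*} {E : ι → Type*} [∀ i, NormedAddCommGroup (E i)]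
    [∀ i, NormedSpace ℝ (E i)] {X : Type*} [NormedAddCommGroup X] [NormedSpace ℝ X]
    [CompleteSpace X] {K : ℝ} (a : ∀ i, E i →L[ℝ] X) (ha : ∀ i, ‖a i‖ ≤ K) :
    ∃ C : lp E 1 →L[ℝ] X, ∀ x, HasSum (fun i => a i (x i)) (C x) := by
  have hb : ∀ i e, ‖a i e‖ ≤ K * ‖e‖ := fun i e => (a i).le_of_opNorm_le (ha i) e
  have hn : ∀ x : lp E 1, HasSum (fun i => ‖x i‖) ‖x‖ := fun x => by
    simpa using lp.hasSum_norm (p := 1) (by simp) x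
  have hs : ∀ x : lp E 1, Summable (fun i => a i (x i)) := fun x =>
    .of_norm_bounded ((hn x).summable.mul_left K) fun i => hb i (x i)
  let L : lp E 1 →ₗ[ℝ] X :=
    { toFun := fun x => ∑' i, a i (x i)
      map_add' := fun x y => by
        rw [← (hs x).tsum_add (hs y)]
        simp
      map_smul' := fun r x => by
        simp [(hs x).tsum_const_smul] }
  exact ⟨L.mkContinuous K fun x =>
    tsum_of_norm_bounded ((hn x).mul_left K) fun i => hb i (x i), fun x => (hs x).hasSum⟩

/-- A functional on `G` dominated by `K` times the distance to `M` extends to a functional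
vanishing on `M` of norm at most `K`. -/
lemma exists_dual_extension_vanishing {Y : Type*} [NormedAddCommGroup Y] [NormedSpace ℝ Y]
    (G M : Submodule ℝ Y) (a : Y →ₗ[ℝ] ℝ) {K : ℝ} (hK : 0 ≤ K)
    (h : ∀ g ∈ G, ∀ m ∈ M, a g ≤ K * ‖g + m‖) :
    ∃ a' : Y →L[ℝ] ℝ, ‖a'‖ ≤ K ∧ (∀ g ∈ G, a' g = a g) ∧ ∀ m ∈ M, a' m = 0 := by
  obtain ⟨f, hf, hle⟩ := exists_extension_of_le_sublinear ⟨G, a.domRestrict G⟩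
    (fun y => K * ‖M.mkQ y‖)
    (fun r hr x => by
      rw [map_smul, norm_smul, Real.norm_of_nonneg hr.le]
      ring)
    (fun x y => by
      rw [map_add, ← mul_add]
      exact mul_le_mul_of_nonneg_left (norm_add_le _ _) hK)
    (by
      rintro ⟨g, hg⟩
      change a g ≤ K * ‖M.mkQ g‖
      refine le_of_forall_pos_le_add fun ε hε => ?_
      obtain ⟨y, hy, hlt⟩ := Submodule.Quotient.norm_mk_lt (M.mkQ g)
        (ε := ε / (K + 1)) (by positivity)
      have hm : y - g ∈ M := (Submodule.Quotient.eq M).1 hy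
      have h1 := h g hg _ hm
      rw [add_sub_cancel] at h1
      have h2 : K * (ε / (K + 1)) ≤ ε := by
        rw [mul_div_assoc', div_le_iff₀ (by positivity)]
        nlinarith
      nlinarith [mul_le_mul_of_nonneg_left hlt.le hK])
  have habs : ∀ y, |f y| ≤ K * ‖M.mkQ y‖ := fun y => abs_le'.2
    ⟨hle y, by simpa using hle (-y)⟩
  have hb : ∀ y, ‖f y‖ ≤ K * ‖y‖ := fun y =>
    (habs y).trans (mul_le_mul_of_nonneg_left (Submodule.Quotient.norm_mk_le M y) hK)
  refine ⟨f.mkContinuous K hb, f.mkContinuous_norm_le hK hb, fun g hg => hf ⟨g, hg⟩,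
    fun m hm => ?_⟩
  have h0 := habs m
  rw [Submodule.mkQ_apply, (Submodule.Quotient.mk_eq_zero M).2 hm, norm_zero, mul_zero] at h0
  exact abs_nonpos_iff.1 h0

/-- Injectivity of `ℓ∞`, in a form where the extension vanishes on a prescribed subspace. -/
lemma exists_ellInfty_extension_vanishing {Y : Type*} [NormedAddCommGroup Y] [NormedSpace ℝ Y]
    (G M : Submodule ℝ Y) (A : Y →L[ℝ] ellInfty) {K : ℝ} (hK : 0 ≤ K)
    (h : ∀ g ∈ G, ∀ m ∈ M, ‖A g‖ ≤ K * ‖g + m‖) :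
    ∃ A' : Y →L[ℝ] ellInfty, ‖A'‖ ≤ K ∧ (∀ g ∈ G, A' g = A g) ∧ ∀ m ∈ M, A' m = 0 := by
  have key : ∀ k : ℕ, ∃ a' : Y →L[ℝ] ℝ, ‖a'‖ ≤ K ∧ (∀ g ∈ G, a' g = A g k) ∧
      ∀ m ∈ M, a' m = 0 := fun k =>
    exists_dual_extension_vanishing G M
      ((lp.evalCLM ℝ (fun _ : ℕ => ℝ) ⊤ k).comp A).toLinearMap hK fun g hg m hm =>
        (le_abs_self _).trans
          ((lp.norm_apply_le_norm ENNReal.top_ne_zero (A g) k).trans (h g hg m hm))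
  choose a hn hG hM using key
  obtain ⟨A', hA', hval⟩ := exists_clm_lp_infty hK a hn
  refine ⟨A', hA', fun g hg => ?_, fun m hm => ?_⟩
  · ext k
    rw [hval, hG k g hg]
  · ext k
    rw [hval, hM k m hm]
    rfl

/-- Mazur's lemma: a finite-dimensional subspace is `2`-normed modulo the common kernel of finitely many
functionals. -/
lemma exists_finset_dual_norm_le {Y : Type*} [NormedAddCommGroup Y] [NormedSpace ℝ Y]
    (F : Submodule ℝ Y) [FiniteDimensional ℝ F] :
    ∃ s : Finset (StrongDual ℝ Y), ∀ f ∈ F, ∀ w, (∀ φ ∈ s, φ w = 0) → ‖f‖ ≤ 2 * ‖f + w‖ := by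
  classical
  have hcomp : IsCompact (Metric.sphere (0 : F) 1) := isCompact_sphere 0 1
  choose ψ hψ hψv using fun y : Y => exists_dual_vector'' ℝ y
  obtain ⟨t, ht⟩ := hcomp.elim_finite_subcover
    (fun y : F => {f : F | (1 / 2 : ℝ) < ψ y f})
    (fun y => isOpen_lt continuous_const ((ψ y).continuous.comp continuous_subtype_val))
    (fun y hy => Set.mem_iUnion.2 ⟨y, by
      have h1 : ‖(y : Y)‖ = 1 := by simpa using hy
      change (1 / 2 : ℝ) < ψ y y
      rw [hψv, h1]
      norm_num⟩)
  refine ⟨t.image fun y : F => ψ y, fun f hf w hw => ?_⟩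
  rcases eq_or_ne f 0 with rfl | hf0
  · simp
  have hpos : 0 < ‖f‖ := norm_pos_iff.2 hf0
  have hmem : (‖f‖⁻¹ • ⟨f, hf⟩ : F) ∈ Metric.sphere (0 : F) 1 := by
    rw [mem_sphere_zero_iff_norm, norm_smul, norm_inv, norm_norm]
    exact inv_mul_cancel₀ hpos.ne'
  obtain ⟨y, hyt, hy⟩ := Set.mem_iUnion₂.1 (ht hmem)
  have hy' : (1 / 2 : ℝ) < ‖f‖⁻¹ * ψ y f := by simpa using hy
  rw [inv_mul_eq_div, lt_div_iff₀ hpos] at hy'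
  have hz : ψ y w = 0 := hw _ (Finset.mem_image_of_mem _ hyt)
  have h1 : ψ y (f + w) ≤ 1 * ‖f + w‖ :=
    (le_abs_self _).trans ((ψ y).le_of_opNorm_le (hψ y) _)
  rw [map_add, hz] at h1
  linarith

/-- A finite-dimensional subspace of `Y` together with finitely many functionals whose common
kernel is transversal to it, with constant `2`. -/
structure MazurPair (Y : Type*) [NormedAddCommGroup Y] [NormedSpace ℝ Y] where
  /-- The finite-dimensional subspace. -/
  space : Submodule ℝ Y
  /-- The finitely many functionals. -/
  functionals : Finset (StrongDual ℝ Y)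
  finiteDimensional : FiniteDimensional ℝ space
  norm_le : ∀ f ∈ space, ∀ w, (∀ φ ∈ functionals, φ w = 0) → ‖f‖ ≤ 2 * ‖f + w‖

namespace MazurPair

variable {Y : Type*} [NormedAddCommGroup Y] [NormedSpace ℝ Y]

/-- The common kernel of the functionals. -/
def ker (S : MazurPair Y) : Submodule ℝ Y := ⨅ φ ∈ S.functionals, φ.toLinearMap.ker

lemma mem_ker {S : MazurPair Y} {w : Y} : w ∈ S.ker ↔ ∀ φ ∈ S.functionals, φ w = 0 := by
  simp [ker]

lemma isClosed_ker (S : MazurPair Y) : IsClosed (S.ker : Set Y) := by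
  have : (S.ker : Set Y) = ⋂ φ ∈ S.functionals, {w | φ w = 0} := by
    ext w
    simp [mem_ker]
  rw [this]
  exact isClosed_biInter fun φ _ => isClosed_eq φ.continuous continuous_const

lemma finiteDimensional_quotient_comap_ker {X : Type*} [NormedAddCommGroup X] [NormedSpace ℝ X]
    (S : MazurPair Y) (B : X →L[ℝ] Y) :
    FiniteDimensional ℝ (X ⧸ S.ker.comap B.toLinearMap) := by
  let T : X →ₗ[ℝ] (S.functionals → ℝ) :=
    LinearMap.pi fun φ => φ.1.toLinearMap ∘ₗ B.toLinearMap
  have hT : S.ker.comap B.toLinearMap = T.ker := by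
    ext x
    simp [mem_ker, T, funext_iff]
  rw [hT]
  exact T.quotKerEquivRange.symm.finiteDimensional

lemma exists_extend (S : MazurPair Y) (G : Submodule ℝ Y) [FiniteDimensional ℝ G]
    (hG : G ≤ S.ker) (A : Y →L[ℝ] ellInfty) {c : ℝ} (hc : 0 ≤ c) (hA : ‖A‖ ≤ c) :
    ∃ (T : MazurPair Y) (A' : Y →L[ℝ] ellInfty), S.space ≤ T.space ∧ G ≤ T.space ∧
      T.ker ≤ S.ker ∧ ‖A'‖ ≤ 6 * c ∧ (∀ g ∈ G, A' g = A g) ∧ (∀ f ∈ S.space, A' f = 0) ∧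
      ∀ w ∈ T.ker, A' w = 0 := by
  classical
  have := S.finiteDimensional
  obtain ⟨s, hs⟩ := exists_finset_dual_norm_le (S.space ⊔ G)
  let T : MazurPair Y := ⟨S.space ⊔ G, S.functionals ∪ s, inferInstance, fun f hf w hw =>
    hs f hf w fun φ hφ => hw φ (Finset.mem_union_right _ hφ)⟩
  obtain ⟨A', hn, hAG, hAM⟩ := exists_ellInfty_extension_vanishing G (S.space ⊔ T.ker) A
    (K := 6 * c) (by positivity) (by
      intro g hg m hm
      obtain ⟨f, hf, w, hw, rfl⟩ := Submodule.mem_sup.1 hm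
      have h1 : ‖A g‖ ≤ c * ‖g‖ := A.le_of_opNorm_le hA g
      have h2 := S.norm_le f hf g (mem_ker.1 (hG hg))
      have h3 := T.norm_le (f + g) (Submodule.add_mem_sup hf hg) w (mem_ker.1 hw)
      have h4 : ‖g‖ ≤ ‖f + g‖ + ‖f‖ := by
        simpa using norm_sub_le (f + g) f
      have h5 : g + (f + w) = f + g + w := by abel
      rw [h5]
      nlinarith)
  refine ⟨T, A', le_sup_left, le_sup_right, fun w hw => ?_, hn, hAG,
    fun f hf => hAM f (Submodule.mem_sup_left hf), fun w hw => hAM w (Submodule.mem_sup_right hw)⟩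
  exact mem_ker.2 fun φ hφ => mem_ker.1 hw φ (Finset.mem_union_left _ hφ)

end MazurPair

theorem statement12 (p : ENNReal) [Fact (1 ≤ p)] (hp : p ≠ ⊤)
    (j : ∀ n : ℕ, ellPFin p n →L[ℝ] ellInfty)
    (hj : ∀ (n : ℕ) (x : ellPFin p n), ‖j n x‖ = ‖x‖)
    {X Y : Type} [NormedAddCommGroup X] [NormedSpace ℝ X] [CompleteSpace X]
    [NormedAddCommGroup Y] [NormedSpace ℝ Y] [CompleteSpace Y]
    (B : X →L[ℝ] Y) (c : ℝ) (hc : 0 < c)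
    (hfact : ∀ (n : ℕ) (Z : Submodule ℝ X), IsClosed (Z : Set X) →
      FiniteDimensional ℝ (X ⧸ Z) →
      ∃ (C : ellPFin p n →L[ℝ] X) (A : Y →L[ℝ] ellInfty),
        (∀ e, C e ∈ Z) ∧ ‖C‖ ≤ c ∧ ‖A‖ ≤ c ∧ ∀ e, A (B (C e)) = j n e) :
    ∃ (C : ↥(lp (ellPFin p) 1) →L[ℝ] X) (A : Y →L[ℝ] ↥(lp (fun _ : ℕ => ellInfty) ⊤)),
      ∀ (x : ↥(lp (ellPFin p) 1)) (n : ℕ),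
        (A (B (C x)) : ∀ _ : ℕ, ellInfty) n = j n (x n) := by
  have step : ∀ (n : ℕ) (S : MazurPair Y), ∃ (C : ellPFin p n →L[ℝ] X) (T : MazurPair Y)
      (A : Y →L[ℝ] ellInfty), ‖C‖ ≤ c ∧ ‖A‖ ≤ 6 * c ∧ S.space ≤ T.space ∧ T.ker ≤ S.ker ∧
      (∀ e, B (C e) ∈ T.space) ∧ (∀ e, B (C e) ∈ S.ker) ∧ (∀ e, A (B (C e)) = j n e) ∧
      (∀ f ∈ S.space, A f = 0) ∧ ∀ w ∈ T.ker, A w = 0 := by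
    intro n S
    obtain ⟨C, A, hCZ, hC, hA, hfac⟩ := hfact n (S.ker.comap B.toLinearMap)
      (S.isClosed_ker.preimage B.continuous) (S.finiteDimensional_quotient_comap_ker B)
    obtain ⟨T, A', h1, h2, h3, h4, h5, h6, h7⟩ :=
      S.exists_extend (B.comp C).toLinearMap.range
        (by
          rintro _ ⟨e, rfl⟩
          exact hCZ e) A hc.le hA
    exact ⟨C, T, A', hC, h4, h1, h3, fun e => h2 ⟨e, rfl⟩, hCZ,
      fun e => (h5 _ ⟨e, rfl⟩).trans (hfac e), h6, h7⟩
  choose C T A hC hA hsp hker hBT hBS hAj hAS hAT using step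
  let S₀ : MazurPair Y := ⟨⊥, ∅, inferInstance, fun f hf w _ => by
    rw [(Submodule.mem_bot ℝ).1 hf, norm_zero]
    positivity⟩
  let S : ℕ → MazurPair Y := fun n => Nat.rec S₀ (fun n S => T n S) n
  have hSmono : Monotone fun n => (S n).space :=
    monotone_nat_of_le_succ fun n => hsp n (S n)
  have hSanti : Antitone fun n => (S n).ker :=
    antitone_nat_of_succ_le fun n => hker n (S n)
  have hzero : ∀ m n e, n ≠ m → A m (S m) (B (C n (S n) e)) = 0 := by
    intro m n e hne
    rcases hne.lt_or_gt with h | h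
    · exact hAS m (S m) _ (hSmono (Nat.succ_le_of_lt h) (hBT n (S n) e))
    · exact hAT m (S m) _ (hSanti (Nat.succ_le_of_lt h) (hBS n (S n) e))
  obtain ⟨C', hC'⟩ := exists_clm_lp_one (fun n => C n (S n)) fun n => hC n (S n)
  obtain ⟨A', -, hA'⟩ := exists_clm_lp_infty (K := 6 * c) (by positivity)
    (fun n => A n (S n)) fun n => hA n (S n)
  refine ⟨C', A', fun x n => ?_⟩
  rw [hA']
  have h1 := (hC' x).mapL ((A n (S n)).comp B)
  have h2 := hasSum_single (f := fun i => ((A n (S n)).comp B) (C i (S i) (x i))) n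
    fun i hi => hzero n i (x i) hi
  exact (h1.unique h2).trans (hAj n (S n) (x n))
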